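/- The closest injective tensor product: Let ⊗_α be a tensor product of convex bodies of order l, and define ⊗_{α^{inj}} by P_1⊗_{α^{inj}}⋯⊗_{α^{inj}}P_l := ⋂{P_1⊗_β⋯⊗_βP_l : ⊗_β is an injective tensor product of convex bodies with ⊗_α ⊆ ⊗_β}. Then ⊗_{α^{inj}} is an injective tensor product of convex bodies, ⊗_α ⊆ ⊗_{α^{inj}}, and ⊗_{α^{inj}} is the smallest such: every injective tensor product of convex bodies ⊗_β with ⊗_α ⊆ ⊗_β satisfies ⊗_{α^{inj}} ⊆ ⊗_β. -/

import Mathlib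

open scoped TensorProduct RealInnerProductSpace Pointwise
open PiTensorProduct

noncomputable section

variable {l : ℕ}

/-- The Hilbert tensor inner product on `⨂[ℝ] i, E i`, determined on decomposable
tensors by `⟪⨂ₜ x i, ⨂ₜ y i⟫_H = ∏ i, ⟪x i, y i⟫`. -/
def tensorInner (E : Fin l → Type) [∀ i, NormedAddCommGroup (E i)]
    [∀ i, InnerProductSpace ℝ (E i)] :
    (⨂[ℝ] i, E i) →ₗ[ℝ] (⨂[ℝ] i, E i) →ₗ[ℝ] ℝ :=
  (PiTensorProduct.map₂ (fun i => innerₗ (E i))).compr₂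
    (PiTensorProduct.lift (MultilinearMap.mkPiAlgebra ℝ (Fin l) ℝ))

/-- The polar of a set with respect to a bilinear pairing `B`:
`C° = {z | ∀ u ∈ C, B u z ≤ 1}`. -/
def polarB {V : Type*} [AddCommGroup V] [Module ℝ V]
    (B : V →ₗ[ℝ] V →ₗ[ℝ] ℝ) (C : Set V) : Set V :=
  {z | ∀ u ∈ C, B u z ≤ 1}

/-- The projective tensor product of sets:
`P₁ ⊗_π ⋯ ⊗_π P_l = conv {x¹ ⊗ ⋯ ⊗ x^l : xⁱ ∈ P i}`. -/
def projTP (E : Fin l → Type) [∀ i, NormedAddCommGroup (E i)]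
    [∀ i, InnerProductSpace ℝ (E i)] (P : ∀ i, Set (E i)) : Set (⨂[ℝ] i, E i) :=
  convexHull ℝ {u | ∃ x : ∀ i, E i, (∀ i, x i ∈ P i) ∧ u = ⨂ₜ[ℝ] i, x i}

/-- The injective tensor product of sets:
`P₁ ⊗_ε ⋯ ⊗_ε P_l = (P₁° ⊗_π ⋯ ⊗_π P_l°)°`, polars taken with respect to the
Hilbert tensor inner product. -/
def injTP (E : Fin l → Type) [∀ i, NormedAddCommGroup (E i)]
    [∀ i, InnerProductSpace ℝ (E i)] (P : ∀ i, Set (E i)) : Set (⨂[ℝ] i, E i) :=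
  polarB (tensorInner E) (projTP E (fun i => polarB (innerₗ (E i)) (P i)))

/-- The canonical topology on the (finite-dimensional) tensor product space, defined
instance-free as the weak topology induced by all linear functionals; for
finite-dimensional real vector spaces this is the canonical (Euclidean) topology. -/
instance tensorTopology (E : Fin l → Type) [∀ i, NormedAddCommGroup (E i)]
    [∀ i, InnerProductSpace ℝ (E i)] : TopologicalSpace (⨂[ℝ] i, E i) :=
  ⨅ (f : (⨂[ℝ] i, E i) →ₗ[ℝ] ℝ), TopologicalSpace.induced f inferInstance

/-- A convex body: a compact convex set with nonempty interior. -/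
def IsConvexBody {V : Type*} [AddCommGroup V] [Module ℝ V] [TopologicalSpace V]
    (P : Set V) : Prop :=
  IsCompact P ∧ Convex ℝ P ∧ (interior P).Nonempty

/-- A convex body containing `0` in its interior. -/
def IsZeroBody {V : Type*} [AddCommGroup V] [Module ℝ V] [TopologicalSpace V]
    (P : Set V) : Prop :=
  IsCompact P ∧ Convex ℝ P ∧ 0 ∈ interior P

/-- A `0`-symmetric convex body. -/
def IsSymBody {V : Type*} [AddCommGroup V] [Module ℝ V] [TopologicalSpace V]
    (P : Set V) : Prop :=
  IsConvexBody P ∧ P = -P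

/-- An assignment, to every `l`-tuple of finite-dimensional real inner product spaces
and every `l`-tuple of subsets thereof, of a subset of the tensor product space. -/
abbrev TPAssignment (l : ℕ) : Type 1 :=
  ∀ (E : Fin l → Type) [∀ i, NormedAddCommGroup (E i)] [∀ i, InnerProductSpace ℝ (E i)]
    [∀ i, FiniteDimensional ℝ (E i)], (∀ i, Set (E i)) → Set (⨂[ℝ] i, E i)

/-- A tensor product of (order `l` of) convex bodies with zero in the interior:
on every tuple of convex bodies with `0` in the interior its value is a convex body
sandwiched between the projective and the injective tensor products, and it has the
uniform property. -/
def IsTPB (A : TPAssignment l) : Prop :=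
  (∀ (E : Fin l → Type) [∀ i, NormedAddCommGroup (E i)] [∀ i, InnerProductSpace ℝ (E i)]
      [∀ i, FiniteDimensional ℝ (E i)] (P : ∀ i, Set (E i)), (∀ i, IsZeroBody (P i)) →
      IsConvexBody (A E P) ∧ projTP E P ⊆ A E P ∧ A E P ⊆ injTP E P) ∧
  (∀ (E F : Fin l → Type) [∀ i, NormedAddCommGroup (E i)] [∀ i, InnerProductSpace ℝ (E i)]
      [∀ i, FiniteDimensional ℝ (E i)] [∀ i, NormedAddCommGroup (F i)]
      [∀ i, InnerProductSpace ℝ (F i)] [∀ i, FiniteDimensional ℝ (F i)]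
      (P : ∀ i, Set (E i)) (Q : ∀ i, Set (F i)) (T : ∀ i, E i →ₗ[ℝ] F i),
      (∀ i, IsZeroBody (P i)) → (∀ i, IsZeroBody (Q i)) → (∀ i, T i '' P i ⊆ Q i) →
      PiTensorProduct.map T '' A E P ⊆ A F Q)

/-- A tensor product of (order `l` of) `0`-symmetric convex bodies. -/
def IsTPSym (A : TPAssignment l) : Prop :=
  (∀ (E : Fin l → Type) [∀ i, NormedAddCommGroup (E i)] [∀ i, InnerProductSpace ℝ (E i)]
      [∀ i, FiniteDimensional ℝ (E i)] (P : ∀ i, Set (E i)), (∀ i, IsSymBody (P i)) →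
      IsSymBody (A E P) ∧ projTP E P ⊆ A E P ∧ A E P ⊆ injTP E P) ∧
  (∀ (E F : Fin l → Type) [∀ i, NormedAddCommGroup (E i)] [∀ i, InnerProductSpace ℝ (E i)]
      [∀ i, FiniteDimensional ℝ (E i)] [∀ i, NormedAddCommGroup (F i)]
      [∀ i, InnerProductSpace ℝ (F i)] [∀ i, FiniteDimensional ℝ (F i)]
      (P : ∀ i, Set (E i)) (Q : ∀ i, Set (F i)) (T : ∀ i, E i →ₗ[ℝ] F i),
      (∀ i, IsSymBody (P i)) → (∀ i, IsSymBody (Q i)) → (∀ i, T i '' P i ⊆ Q i) →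
      PiTensorProduct.map T '' A E P ⊆ A F Q)

/-- The dual of an assignment: `P₁ ⊗_{α'} ⋯ ⊗_{α'} P_l = (P₁° ⊗_α ⋯ ⊗_α P_l°)°`. -/
def dualTP (A : TPAssignment l) : TPAssignment l :=
  fun E _ _ _ P =>
    polarB (tensorInner E) (A E (fun i => polarB (innerₗ (E i)) (P i)))

/-- The order on tensor products of convex bodies with zero in the interior. -/
def leTPB (A B : TPAssignment l) : Prop :=
  ∀ (E : Fin l → Type) [∀ i, NormedAddCommGroup (E i)] [∀ i, InnerProductSpace ℝ (E i)]
    [∀ i, FiniteDimensional ℝ (E i)] (P : ∀ i, Set (E i)), (∀ i, IsZeroBody (P i)) →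
    A E P ⊆ B E P

/-- The order on tensor products of `0`-symmetric convex bodies. -/
def leTPSym (A B : TPAssignment l) : Prop :=
  ∀ (E : Fin l → Type) [∀ i, NormedAddCommGroup (E i)] [∀ i, InnerProductSpace ℝ (E i)]
    [∀ i, FiniteDimensional ℝ (E i)] (P : ∀ i, Set (E i)), (∀ i, IsSymBody (P i)) →
    A E P ⊆ B E P

/-- Injectivity of a tensor product of convex bodies: it respects sections by subspaces. -/
def IsInjectiveTPB (A : TPAssignment l) : Prop :=
  ∀ (E : Fin l → Type) [∀ i, NormedAddCommGroup (E i)] [∀ i, InnerProductSpace ℝ (E i)]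
    [∀ i, FiniteDimensional ℝ (E i)] (P : ∀ i, Set (E i)) (M : ∀ i, Submodule ℝ (E i)),
    (∀ i, IsZeroBody (P i)) →
    PiTensorProduct.map (fun i => (M i).subtype) ''
        A (fun i => ↥(M i)) (fun i => Subtype.val ⁻¹' P i)
      = A E P ∩ Set.range (PiTensorProduct.map (fun i => (M i).subtype))

/-- Projectivity of a tensor product of convex bodies: it respects quotients. -/
def IsProjectiveTPB (A : TPAssignment l) : Prop :=
  ∀ (E F : Fin l → Type) [∀ i, NormedAddCommGroup (E i)] [∀ i, InnerProductSpace ℝ (E i)]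
    [∀ i, FiniteDimensional ℝ (E i)] [∀ i, NormedAddCommGroup (F i)]
    [∀ i, InnerProductSpace ℝ (F i)] [∀ i, FiniteDimensional ℝ (F i)]
    (P : ∀ i, Set (E i)) (T : ∀ i, E i →ₗ[ℝ] F i),
    (∀ i, IsZeroBody (P i)) → (∀ i, Function.Surjective (T i)) →
    PiTensorProduct.map T '' A E P = A F (fun i => T i '' P i)

/-- Injectivity of a tensor product of `0`-symmetric convex bodies. -/
def IsInjectiveSym (A : TPAssignment l) : Prop :=
  ∀ (E : Fin l → Type) [∀ i, NormedAddCommGroup (E i)] [∀ i, InnerProductSpace ℝ (E i)]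
    [∀ i, FiniteDimensional ℝ (E i)] (P : ∀ i, Set (E i)) (M : ∀ i, Submodule ℝ (E i)),
    (∀ i, IsSymBody (P i)) →
    PiTensorProduct.map (fun i => (M i).subtype) ''
        A (fun i => ↥(M i)) (fun i => Subtype.val ⁻¹' P i)
      = A E P ∩ Set.range (PiTensorProduct.map (fun i => (M i).subtype))

/-- Projectivity of a tensor product of `0`-symmetric convex bodies. -/
def IsProjectiveSym (A : TPAssignment l) : Prop :=
  ∀ (E F : Fin l → Type) [∀ i, NormedAddCommGroup (E i)] [∀ i, InnerProductSpace ℝ (E i)]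
    [∀ i, FiniteDimensional ℝ (E i)] [∀ i, NormedAddCommGroup (F i)]
    [∀ i, InnerProductSpace ℝ (F i)] [∀ i, FiniteDimensional ℝ (F i)]
    (P : ∀ i, Set (E i)) (T : ∀ i, E i →ₗ[ℝ] F i),
    (∀ i, IsSymBody (P i)) → (∀ i, Function.Surjective (T i)) →
    PiTensorProduct.map T '' A E P = A F (fun i => T i '' P i)

/-- The intersection of all injective tensor products of convex bodies above `A`. -/
def injHullB (A : TPAssignment l) : TPAssignment l :=
  fun E _ _ _ P =>
    ⋂ B ∈ {B : TPAssignment l | IsTPB B ∧ IsInjectiveTPB B ∧ leTPB A B}, B E P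

/-- The intersection of all injective tensor products of `0`-symmetric convex bodies
above `A`. -/
def injHullSym (A : TPAssignment l) : TPAssignment l :=
  fun E _ _ _ P =>
    ⋂ B ∈ {B : TPAssignment l | IsTPSym B ∧ IsInjectiveSym B ∧ leTPSym A B}, B E P

/-- The projective hull `⊗_{α^{proj}} = ⊗_{((α')^{inj})'}` (convex bodies version). -/
def projHullB (A : TPAssignment l) : TPAssignment l :=
  dualTP (injHullB (dualTP A))

/-- The projective hull `⊗_{α^{proj}} = ⊗_{((α')^{inj})'}` (`0`-symmetric version). -/
def projHullSym (A : TPAssignment l) : TPAssignment l :=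
  dualTP (injHullSym (dualTP A))

/-- The Banach–Mazur distance between `0`-symmetric convex bodies:
`inf {λ ≥ 1 : ∃ bijective linear T, Q ⊆ T(P) ⊆ λQ}`. -/
def deltaBM {V : Type*} [AddCommGroup V] [Module ℝ V] (P Q : Set V) : ℝ :=
  sInf {lam : ℝ | 1 ≤ lam ∧ ∃ T : V ≃ₗ[ℝ] V, Q ⊆ T '' P ∧ T '' P ⊆ lam • Q}

/-- The projective tensor norm `π` on the tensor product of normed spaces. -/
def projNorm (M : Fin l → Type) [∀ i, NormedAddCommGroup (M i)] [∀ i, NormedSpace ℝ (M i)]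
    (u : ⨂[ℝ] i, M i) : ℝ :=
  sInf {r | ∃ (n : ℕ) (x : Fin n → ∀ i, M i),
    u = (∑ j, ⨂ₜ[ℝ] i, x j i) ∧ r = ∑ j, ∏ i, ‖x j i‖}

/-- The injective tensor norm `ε` on the tensor product of normed spaces:
`ε(u) = sup {|x₁* ⊗ ⋯ ⊗ x_l* (u)| : ‖x_i*‖ ≤ 1}`. -/
def injNorm (M : Fin l → Type) [∀ i, NormedAddCommGroup (M i)] [∀ i, NormedSpace ℝ (M i)]
    (u : ⨂[ℝ] i, M i) : ℝ :=
  sSup {r | ∃ f : ∀ i, M i →L[ℝ] ℝ, (∀ i, ‖f i‖ ≤ 1) ∧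
    r = |PiTensorProduct.lift ((MultilinearMap.mkPiAlgebra ℝ (Fin l) ℝ).compLinearMap
        (fun i => (f i : M i →ₗ[ℝ] ℝ))) u|}

/-- An assignment of a real-valued function on the tensor product of every `l`-tuple of
finite-dimensional Banach spaces. -/
abbrev TNAssignment (l : ℕ) : Type 1 :=
  ∀ (M : Fin l → Type) [∀ i, NormedAddCommGroup (M i)] [∀ i, NormedSpace ℝ (M i)]
    [∀ i, FiniteDimensional ℝ (M i)], (⨂[ℝ] i, M i) → ℝ

/-- A tensor norm of order `l` on the class of finite-dimensional Banach spaces: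
on each tuple it is a norm which is a reasonable crossnorm (`ε ≤ α ≤ π`), and it
satisfies the uniform property. -/
def IsTensorNormFD (ν : TNAssignment l) : Prop :=
  (∀ (M : Fin l → Type) [∀ i, NormedAddCommGroup (M i)] [∀ i, NormedSpace ℝ (M i)]
      [∀ i, FiniteDimensional ℝ (M i)] (u v : ⨂[ℝ] i, M i),
      ν M (u + v) ≤ ν M u + ν M v) ∧
  (∀ (M : Fin l → Type) [∀ i, NormedAddCommGroup (M i)] [∀ i, NormedSpace ℝ (M i)]
      [∀ i, FiniteDimensional ℝ (M i)] (c : ℝ) (u : ⨂[ℝ] i, M i),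
      ν M (c • u) = |c| * ν M u) ∧
  (∀ (M : Fin l → Type) [∀ i, NormedAddCommGroup (M i)] [∀ i, NormedSpace ℝ (M i)]
      [∀ i, FiniteDimensional ℝ (M i)] (u : ⨂[ℝ] i, M i),
      ν M u = 0 → u = 0) ∧
  (∀ (M : Fin l → Type) [∀ i, NormedAddCommGroup (M i)] [∀ i, NormedSpace ℝ (M i)]
      [∀ i, FiniteDimensional ℝ (M i)] (u : ⨂[ℝ] i, M i),
      injNorm M u ≤ ν M u ∧ ν M u ≤ projNorm M u) ∧
  (∀ (M N : Fin l → Type) [∀ i, NormedAddCommGroup (M i)] [∀ i, NormedSpace ℝ (M i)]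
      [∀ i, FiniteDimensional ℝ (M i)] [∀ i, NormedAddCommGroup (N i)]
      [∀ i, NormedSpace ℝ (N i)] [∀ i, FiniteDimensional ℝ (N i)]
      (T : ∀ i, M i →L[ℝ] N i) (u : ⨂[ℝ] i, M i),
      ν N (PiTensorProduct.map (fun i => (T i : M i →ₗ[ℝ] N i)) u)
        ≤ (∏ i, ‖T i‖) * ν M u)

/-- `Corresponds A ν` : the tensor product of `0`-symmetric convex bodies `A` and the
tensor norm `ν` correspond to each other under Minkowski's bijection, i.e. for every
tuple of `0`-symmetric convex bodies `P i ⊆ E i` and every isometric model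
`e i : (M i, ‖·‖) ≃ (E i, g_{P i})` of the associated finite-dimensional Banach spaces,
`A E P` is the image of the closed unit ball of `ν` on `⨂ M i`. -/
def Corresponds (A : TPAssignment l) (ν : TNAssignment l) : Prop :=
  ∀ (E : Fin l → Type) [∀ i, NormedAddCommGroup (E i)] [∀ i, InnerProductSpace ℝ (E i)]
    [∀ i, FiniteDimensional ℝ (E i)]
    (M : Fin l → Type) [∀ i, NormedAddCommGroup (M i)] [∀ i, NormedSpace ℝ (M i)]
    [∀ i, FiniteDimensional ℝ (M i)]
    (P : ∀ i, Set (E i)), (∀ i, IsSymBody (P i)) →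
    ∀ (e : ∀ i, M i ≃ₗ[ℝ] E i), (∀ i (x : M i), ‖x‖ = gauge (P i) (e i x)) →
    A E P = PiTensorProduct.map (fun i => (e i : M i →ₗ[ℝ] E i)) '' {z | ν M z ≤ 1}

/-- A tensor norm is injective if the natural inclusions of subspace tensor products
are isometries. -/
def IsInjectiveTN (ν : TNAssignment l) : Prop :=
  ∀ (X : Fin l → Type) [∀ i, NormedAddCommGroup (X i)] [∀ i, NormedSpace ℝ (X i)]
    [∀ i, FiniteDimensional ℝ (X i)] (S : ∀ i, Submodule ℝ (X i)) (u : ⨂[ℝ] i, ↥(S i)),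
    ν (fun i => ↥(S i)) u = ν X (PiTensorProduct.map (fun i => (S i).subtype) u)

/-- A tensor norm is projective if tensor products of quotient operators (operators
mapping the open unit ball onto the open unit ball) are quotient operators. -/
def IsProjectiveTN (ν : TNAssignment l) : Prop :=
  ∀ (X Y : Fin l → Type) [∀ i, NormedAddCommGroup (X i)] [∀ i, NormedSpace ℝ (X i)]
    [∀ i, FiniteDimensional ℝ (X i)] [∀ i, NormedAddCommGroup (Y i)]
    [∀ i, NormedSpace ℝ (Y i)] [∀ i, FiniteDimensional ℝ (Y i)]
    (T : ∀ i, X i →L[ℝ] Y i),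
    (∀ i, (T i) '' Metric.ball 0 1 = Metric.ball 0 1) →
    {w : ⨂[ℝ] i, Y i | ν Y w < 1}
      = PiTensorProduct.map (fun i => (T i : X i →ₗ[ℝ] Y i)) '' {u | ν X u < 1}

/-- The canonical pairing between `⨂ (M i)*` and `⨂ M i`. -/
def dualPairing (M : Fin l → Type) [∀ i, NormedAddCommGroup (M i)]
    [∀ i, NormedSpace ℝ (M i)] :
    (⨂[ℝ] i, (M i →L[ℝ] ℝ)) →ₗ[ℝ] (⨂[ℝ] i, M i) →ₗ[ℝ] ℝ :=
  (PiTensorProduct.map₂ (fun i => ContinuousLinearMap.coeLM ℝ)).compr₂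
    (PiTensorProduct.lift (MultilinearMap.mkPiAlgebra ℝ (Fin l) ℝ))


/-- The projective tensor product `⊗_π` as an assignment. -/
def projA (l : ℕ) : TPAssignment l := fun E _ _ _ P => projTP E P

/-- The injective tensor product `⊗_ε` as an assignment. -/
def injA (l : ℕ) : TPAssignment l := fun E _ _ _ P => injTP E P

/-- The pointwise order on assignments of tensor norms. -/
def leTN (ν₁ ν₂ : TNAssignment l) : Prop :=
  ∀ (M : Fin l → Type) [∀ i, NormedAddCommGroup (M i)] [∀ i, NormedSpace ℝ (M i)]
    [∀ i, FiniteDimensional ℝ (M i)] (z : ⨂[ℝ] i, M i), ν₁ M z ≤ ν₂ M z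

/-- Pointwise equality of assignments of tensor norms. -/
def eqTN (ν₁ ν₂ : TNAssignment l) : Prop :=
  ∀ (M : Fin l → Type) [∀ i, NormedAddCommGroup (M i)] [∀ i, NormedSpace ℝ (M i)]
    [∀ i, FiniteDimensional ℝ (M i)] (z : ⨂[ℝ] i, M i), ν₁ M z = ν₂ M z

/-- Equality of two assignments on all tuples of `0`-symmetric convex bodies. -/
def eqOnSymBodies (A A' : TPAssignment l) : Prop :=
  ∀ (E : Fin l → Type) [∀ i, NormedAddCommGroup (E i)] [∀ i, InnerProductSpace ℝ (E i)]
    [∀ i, FiniteDimensional ℝ (E i)] (P : ∀ i, Set (E i)), (∀ i, IsSymBody (P i)) →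
    A E P = A' E P

/-- `ν'` is the dual tensor norm of `ν`:
`ν'(u) = sup {|φ(u)| : φ ∈ ⨂ᵢ Mᵢ*, ν_{M₁*,…,M_l*}(φ) ≤ 1}`. -/
def IsDualTN (ν ν' : TNAssignment l) : Prop :=
  ∀ (M : Fin l → Type) [∀ i, NormedAddCommGroup (M i)] [∀ i, NormedSpace ℝ (M i)]
    [∀ i, FiniteDimensional ℝ (M i)] (u : ⨂[ℝ] i, M i),
    ν' M u = sSup {r | ∃ φ : ⨂[ℝ] i, (M i →L[ℝ] ℝ),
      ν (fun i => M i →L[ℝ] ℝ) φ ≤ 1 ∧ r = |dualPairing M φ u|}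

/-- The image, under the continuous extension of `⨂ᵢ qᵢ` to the completed injective
tensor product `ℓ₁ ⊗̂_ε ⋯ ⊗̂_ε ℓ₁`, of the closed unit ball of that completion.
Since the closed unit ball of the completion is the closure of the closed unit ball of
the algebraic injective tensor product `(⨂ᵢ ℓ₁, ε)`, and since the extension is
continuous, this image is exactly the set of limits of images of `ε`-Cauchy sequences
from the algebraic `ε`-unit ball. -/
def completedEpsBallImage {l : ℕ} (E : Fin l → Type) [∀ i, NormedAddCommGroup (E i)]
    [∀ i, InnerProductSpace ℝ (E i)]
    (q : ∀ i, lp (fun _ : ℕ => ℝ) 1 →ₗ[ℝ] E i) : Set (⨂[ℝ] i, E i) :=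
  {y | ∃ u : ℕ → ⨂[ℝ] _i : Fin l, lp (fun _ : ℕ => ℝ) 1,
    (∀ n, injNorm (fun _ : Fin l => lp (fun _ : ℕ => ℝ) 1) (u n) ≤ 1) ∧
    (∀ δ : ℝ, 0 < δ → ∃ N, ∀ m ≥ N, ∀ n ≥ N,
      injNorm (fun _ : Fin l => lp (fun _ : ℕ => ℝ) 1) (u m - u n) < δ) ∧
    Filter.Tendsto (fun n => PiTensorProduct.map q (u n)) Filter.atTop (nhds y)}

end

section TensorTopology

variable {l : ℕ} (E : Fin l → Type) [∀ i, NormedAddCommGroup (E i)]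
  [∀ i, InnerProductSpace ℝ (E i)]

theorem tensorTopology_continuous_linear (f : (⨂[ℝ] i, E i) →ₗ[ℝ] ℝ) : Continuous f :=
  continuous_iInf_dom continuous_induced_dom

theorem tensorTopology_t2Space : T2Space (⨂[ℝ] i, E i) := by
  refine ⟨fun x y hxy => ?_⟩
  obtain ⟨f, hf⟩ : ∃ f : (⨂[ℝ] i, E i) →ₗ[ℝ] ℝ, f x ≠ f y := by
    by_contra! h
    exact hxy (sub_eq_zero.1 ((Module.forall_dual_apply_eq_zero_iff ℝ (x - y)).1 fun f => by
      rw [map_sub, h f, sub_self]))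
  exact separated_by_continuous (tensorTopology_continuous_linear E f) hf

variable {E}

theorem tensorInner_tprod_tprod (x y : ∀ i, E i) :
    tensorInner E (⨂ₜ[ℝ] i, x i) (⨂ₜ[ℝ] i, y i) = ∏ i, inner ℝ (x i) (y i) := by
  simp [tensorInner, PiTensorProduct.map₂_tprod_tprod]

theorem tensorInner_tprod_map {F : Fin l → Type} [∀ i, NormedAddCommGroup (F i)]
    [∀ i, InnerProductSpace ℝ (F i)] (T : ∀ i, E i →ₗ[ℝ] F i) (x : ∀ i, E i) (y : ∀ i, F i)
    (hxy : ∀ i v, inner ℝ (x i) v = inner ℝ (y i) (T i v)) (z : ⨂[ℝ] i, E i) :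
    tensorInner F (⨂ₜ[ℝ] i, y i) (PiTensorProduct.map T z) =
      tensorInner E (⨂ₜ[ℝ] i, x i) z := by
  have h : (tensorInner F (⨂ₜ[ℝ] i, y i)).comp (PiTensorProduct.map T) =
      tensorInner E (⨂ₜ[ℝ] i, x i) := by
    ext v
    simp [tensorInner_tprod_tprod, PiTensorProduct.map_tprod, hxy]
  exact LinearMap.congr_fun h z

theorem mem_injTP_iff (P : ∀ i, Set (E i)) (z : ⨂[ℝ] i, E i) :
    z ∈ injTP E P ↔ ∀ x : ∀ i, E i, (∀ i, x i ∈ polarB (innerₗ (E i)) (P i)) →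
      tensorInner E (⨂ₜ[ℝ] i, x i) z ≤ 1 := by
  constructor
  · intro hz x hx
    exact hz _ (subset_convexHull ℝ _ ⟨x, hx, rfl⟩)
  · intro h u hu
    have hc : Convex ℝ {u | tensorInner E u z ≤ 1} :=
      convex_halfSpace_le ((tensorInner E).flip z).isLinear 1
    refine convexHull_min ?_ hc hu
    rintro _ ⟨x, hx, rfl⟩
    exact h x hx

theorem convex_injTP (P : ∀ i, Set (E i)) : Convex ℝ (injTP E P) := by
  intro z hz w hw a b ha hb hab u hu
  have h1 := hz u hu
  have h2 := hw u hu
  simp only [map_add, map_smul, smul_eq_mul]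
  nlinarith

theorem isClosed_injTP (P : ∀ i, Set (E i)) : IsClosed (injTP E P) := by
  have : injTP E P = ⋂ u ∈ projTP E (fun i => polarB (innerₗ (E i)) (P i)),
      {z | tensorInner E u z ≤ 1} := by
    ext z
    simp [injTP, polarB]
  rw [this]
  exact isClosed_biInter fun u _ =>
    isClosed_le (tensorTopology_continuous_linear E _) continuous_const

theorem sum_tensorInner_basis [∀ i, FiniteDimensional ℝ (E i)] (z : ⨂[ℝ] i, E i) :
    ∑ J : (∀ i, Fin (Module.finrank ℝ (E i))),
      tensorInner E (⨂ₜ[ℝ] i, stdOrthonormalBasis ℝ (E i) (J i)) z •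
        (⨂ₜ[ℝ] i, stdOrthonormalBasis ℝ (E i) (J i)) = z := by
  have h : ∑ J : (∀ i, Fin (Module.finrank ℝ (E i))),
      (tensorInner E (⨂ₜ[ℝ] i, stdOrthonormalBasis ℝ (E i) (J i))).smulRight
        (⨂ₜ[ℝ] i, stdOrthonormalBasis ℝ (E i) (J i)) = LinearMap.id := by
    ext v
    have hv : v = fun i => ∑ j, inner ℝ (stdOrthonormalBasis ℝ (E i) j) (v i) •
        stdOrthonormalBasis ℝ (E i) j :=
      funext fun i => ((stdOrthonormalBasis ℝ (E i)).sum_repr' (v i)).symm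
    conv_rhs => rw [hv]
    simp [tensorInner_tprod_tprod, MultilinearMap.map_sum, MultilinearMap.map_smul_univ]
  simpa using LinearMap.congr_fun h z

theorem exists_pos_smul_mem_polarB {V : Type*} [NormedAddCommGroup V] [InnerProductSpace ℝ V]
    {P : Set V} (hP : IsCompact P) :
    ∃ r : ℝ, 0 < r ∧ ∀ y : V, ‖y‖ ≤ r → y ∈ polarB (innerₗ V) P := by
  obtain ⟨R, hR, hPR⟩ := hP.isBounded.exists_pos_norm_le
  refine ⟨R⁻¹, inv_pos.2 hR, fun y hy x hx => ?_⟩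
  calc inner ℝ x y ≤ ‖x‖ * ‖y‖ := real_inner_le_norm x y
    _ ≤ R * R⁻¹ := by gcongr; exact hPR x hx
    _ = 1 := mul_inv_cancel₀ hR.ne'

theorem isCompact_injTP [∀ i, FiniteDimensional ℝ (E i)] (hl : 0 < l) (P : ∀ i, Set (E i))
    (hP : ∀ i, IsCompact (P i)) : IsCompact (injTP E P) := by
  choose r hr hrP using fun i => exists_pos_smul_mem_polarB (hP i)
  set C : ℝ := ∏ i, r i with hC
  have hCpos : 0 < C := Finset.prod_pos fun i _ => hr i
  let e : (∀ i, Fin (Module.finrank ℝ (E i))) → ⨂[ℝ] i, E i := fun J =>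
    ⨂ₜ[ℝ] i, stdOrthonormalBasis ℝ (E i) (J i)
  let L : ((∀ i, Fin (Module.finrank ℝ (E i))) → ℝ) →ₗ[ℝ] ⨂[ℝ] i, E i :=
    ∑ J, (LinearMap.proj J : (_ → ℝ) →ₗ[ℝ] ℝ).smulRight (e J)
  have hL : Continuous L :=
    continuous_iInf_rng.2 fun f => continuous_induced_rng.2
      (f.comp L).continuous_of_finiteDimensional
  have hbound : ∀ z ∈ injTP E P, ∀ J, |tensorInner E (e J) z| ≤ C⁻¹ := by
    intro z hz J
    rw [mem_injTP_iff] at hz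
    have key : ∀ s : ℝ, |s| = 1 → s * C * tensorInner E (e J) z ≤ 1 := by
      intro s hs
      let c : Fin l → ℝ := fun i => (if i = ⟨0, hl⟩ then s else 1) * r i
      have hc : ∏ i, c i = s * C := by
        simp only [c, Finset.prod_mul_distrib, hC, Finset.prod_ite_eq', Finset.mem_univ, if_true]
      have := hz (fun i => c i • stdOrthonormalBasis ℝ (E i) (J i)) fun i => hrP i _ (by
        rw [norm_smul, (stdOrthonormalBasis ℝ (E i)).norm_eq_one, mul_one, Real.norm_eq_abs,
          abs_mul, abs_of_pos (hr i)]
        split_ifs <;> simp [hs])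
      rw [MultilinearMap.map_smul_univ, hc] at this
      simpa using this
    have h1 := key 1 (by simp)
    have h2 := key (-1) (by simp)
    rw [abs_le, neg_le, ← mul_one C⁻¹, le_inv_mul_iff₀ hCpos, le_inv_mul_iff₀ hCpos]
    constructor <;> linarith
  have hbox : IsCompact (L '' Set.Icc (fun _ => -C⁻¹) (fun _ => C⁻¹)) := isCompact_Icc.image hL
  refine hbox.of_isClosed_subset (isClosed_injTP P) fun z hz => ?_
  refine ⟨fun J => tensorInner E (e J) z, ⟨fun J => ?_, fun J => ?_⟩, ?_⟩
  · exact (abs_le.1 (hbound z hz J)).1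
  · exact (abs_le.1 (hbound z hz J)).2
  · simpa [L] using sum_tensorInner_basis z

theorem map_image_injTP_subset [∀ i, FiniteDimensional ℝ (E i)] {F : Fin l → Type}
    [∀ i, NormedAddCommGroup (F i)] [∀ i, InnerProductSpace ℝ (F i)]
    [∀ i, FiniteDimensional ℝ (F i)] {P : ∀ i, Set (E i)} {Q : ∀ i, Set (F i)}
    (T : ∀ i, E i →ₗ[ℝ] F i) (hT : ∀ i, T i '' P i ⊆ Q i) :
    PiTensorProduct.map T '' injTP E P ⊆ injTP F Q := by
  rintro _ ⟨z, hz, rfl⟩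
  rw [mem_injTP_iff] at hz ⊢
  intro y hy
  rw [tensorInner_tprod_map T (fun i => (T i).adjoint (y i)) y
    (fun i v => LinearMap.adjoint_inner_left _ _ _)]
  refine hz _ fun i x hx => ?_
  have := hy i _ (hT i ⟨x, hx, rfl⟩)
  simpa [LinearMap.adjoint_inner_right] using this

end TensorTopology

/-- Hahn–Banach extension of an element of the polar of a section. -/
theorem exists_mem_polarB_of_section {V : Type*} [NormedAddCommGroup V] [InnerProductSpace ℝ V]
    [FiniteDimensional ℝ V] {P : Set V} (hP : IsZeroBody P) (M : Submodule ℝ V) {y : M}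
    (hy : y ∈ polarB (innerₗ M) (Subtype.val ⁻¹' P)) :
    ∃ x ∈ polarB (innerₗ V) P, ∀ v : M, inner ℝ y v = inner ℝ x (v : V) := by
  obtain ⟨-, hconv, h0⟩ := hP
  have habs : Absorbent ℝ P := absorbent_nhds_zero (mem_interior_iff_mem_nhds.1 h0)
  obtain ⟨g, hg, hgP⟩ := exists_extension_of_le_sublinear ⟨M, innerₗ M y⟩ (gauge P)
    (fun c hc x => gauge_smul_of_nonneg hc.le x) (fun x w => gauge_add_le hconv habs x w)
    (fun m => by
      refine le_csInf habs.gauge_set_nonempty ?_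
      rintro r ⟨hr, p, hp, hpm⟩
      have hpM : p ∈ M := by
        have : p = r⁻¹ • (m : V) := by rw [← hpm]; simp [smul_smul, hr.ne']
        rw [this]
        exact M.smul_mem _ m.2
      have hm : m = r • (⟨p, hpM⟩ : M) := Subtype.ext hpm.symm
      have h1 := hy ⟨p, hpM⟩ hp
      rw [innerₗ_apply_apply, real_inner_comm] at h1
      simp only [LinearPMap.mk_apply, hm, map_smul, smul_eq_mul, innerₗ_apply_apply]
      nlinarith)
  let x : V := (InnerProductSpace.toDual ℝ V).symm (LinearMap.toContinuousLinearMap g)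
  have hx : ∀ v, inner ℝ x v = g v := fun v => by simp [x]
  refine ⟨x, fun v hv => ?_, fun v => ?_⟩
  · rw [innerₗ_apply_apply, real_inner_comm, hx]
    exact (hgP v).trans (gauge_le_one_of_mem hv)
  · rw [hx]
    exact (hg v).symm

theorem map_subtype_injective {l : ℕ} {E : Fin l → Type} [∀ i, AddCommGroup (E i)]
    [∀ i, Module ℝ (E i)] (M : ∀ i, Submodule ℝ (E i)) :
    Function.Injective (PiTensorProduct.map (fun i => (M i).subtype)) := by
  choose T hT using fun i => (M i).subtype.exists_leftInverse_of_injective (M i).ker_subtype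
  refine Function.LeftInverse.injective (g := PiTensorProduct.map T) fun z => ?_
  rw [← LinearMap.comp_apply, ← PiTensorProduct.map_comp]
  simp [hT]

theorem isInjectiveTPB_injA (l : ℕ) : IsInjectiveTPB (injA l) := by
  intro E _ _ _ P M hP
  apply Set.Subset.antisymm
  · refine Set.subset_inter (map_image_injTP_subset _ fun i => ?_) (Set.image_subset_range _ _)
    simp
  · rintro _ ⟨hz, v, rfl⟩
    refine ⟨v, (mem_injTP_iff _ _).2 fun y hy => ?_, rfl⟩
    choose x hxP hx using fun i => exists_mem_polarB_of_section (hP i) (M i) (hy i)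
    rw [← tensorInner_tprod_map (fun i => (M i).subtype) y x hx]
    exact (mem_injTP_iff _ _).1 hz x hxP

theorem isTPB_injA {l : ℕ} (hl : 0 < l) {A : TPAssignment l} (hA : IsTPB A) :
    IsTPB (injA l) := by
  refine ⟨fun E _ _ _ P hP => ?_, fun E F _ _ _ _ _ _ P Q T _ _ hT =>
    map_image_injTP_subset T hT⟩
  obtain ⟨⟨-, -, h_nonempty⟩, hπ, hε⟩ := hA.1 E P hP
  exact ⟨⟨isCompact_injTP hl P fun i => (hP i).1, convex_injTP P,
    h_nonempty.mono (interior_mono hε)⟩, hπ.trans hε, subset_rfl⟩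

/-- In order zero every tensor product of convex bodies is injective. -/
theorem isInjectiveTPB_zero {A : TPAssignment 0} (hA : IsTPB A) : IsInjectiveTPB A := by
  intro E _ _ _ P M hP
  apply Set.Subset.antisymm
  · exact Set.subset_inter (hA.2 _ _ _ _ _ (fun i => i.elim0) hP fun i => i.elim0)
      (Set.image_subset_range _ _)
  · rintro u ⟨hu, v, rfl⟩
    refine ⟨v, ?_, rfl⟩
    have hv := hA.2 E (fun i => M i) P (fun i => Subtype.val ⁻¹' P i) (fun i => i.elim0) hP
      (fun i => i.elim0) (fun i => i.elim0) ⟨_, hu, rfl⟩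
    rw [← LinearMap.comp_apply, ← PiTensorProduct.map_comp] at hv
    convert hv
    rw [show (fun i => (i.elim0 : E i →ₗ[ℝ] M i) ∘ₗ (M i).subtype) = fun i => LinearMap.id from
      funext fun i => i.elim0]
    simp

theorem exists_isInjectiveTPB_ge {l : ℕ} {A : TPAssignment l} (hA : IsTPB A) :
    ∃ B : TPAssignment l, IsTPB B ∧ IsInjectiveTPB B ∧ leTPB A B := by
  rcases Nat.eq_zero_or_pos l with rfl | hl
  · exact ⟨A, hA, isInjectiveTPB_zero hA, fun E _ _ _ P _ => subset_rfl⟩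
  · exact ⟨injA l, isTPB_injA hl hA, isInjectiveTPB_injA l,
      fun E _ _ _ P hP => (hA.1 E P hP).2.2⟩

theorem mem_injHullB {l : ℕ} {A : TPAssignment l} {E : Fin l → Type}
    [∀ i, NormedAddCommGroup (E i)] [∀ i, InnerProductSpace ℝ (E i)]
    [∀ i, FiniteDimensional ℝ (E i)] {P : ∀ i, Set (E i)} {z : ⨂[ℝ] i, E i} :
    z ∈ injHullB A E P ↔
      ∀ B : TPAssignment l, IsTPB B → IsInjectiveTPB B → leTPB A B → z ∈ B E P := by
  simp [injHullB]

/-- **The closest injective tensor product.** For a tensor product of convex bodies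
`⊗_α`, the intersection `⊗_{α^{inj}}` of all injective tensor products of convex
bodies above `⊗_α` is the smallest injective tensor product of convex bodies
containing `⊗_α`. -/
theorem injHullB_spec {l : ℕ} (A : TPAssignment l) (hA : IsTPB A) :
    IsTPB (injHullB A) ∧ IsInjectiveTPB (injHullB A) ∧ leTPB A (injHullB A) ∧
    ∀ B : TPAssignment l, IsTPB B → IsInjectiveTPB B → leTPB A B →
      leTPB (injHullB A) B := by
  have hle : leTPB A (injHullB A) := fun E _ _ _ P hP z hz =>
    mem_injHullB.2 fun B _ _ hAB => hAB E P hP hz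
  have hmin : ∀ B : TPAssignment l, IsTPB B → IsInjectiveTPB B → leTPB A B →
      leTPB (injHullB A) B := fun B hB hBi hAB E _ _ _ P _ z hz =>
    mem_injHullB.1 hz B hB hBi hAB
  obtain ⟨B₀, hB₀, hB₀i, hAB₀⟩ := exists_isInjectiveTPB_ge hA
  refine ⟨⟨fun E _ _ _ P hP => ?_, ?_⟩, ?_, hle, hmin⟩
  · have hsub := hmin B₀ hB₀ hB₀i hAB₀ E P hP
    obtain ⟨⟨-, -, h_nonempty⟩, hπ, -⟩ := hA.1 E P hP
    obtain ⟨⟨hcomp, -, -⟩, -, hε⟩ := hB₀.1 E P hP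
    have := tensorTopology_t2Space E
    refine ⟨⟨hcomp.of_isClosed_subset ?_ hsub, ?_, h_nonempty.mono (interior_mono (hle E P hP))⟩,
      hπ.trans (hle E P hP), hsub.trans hε⟩
    · exact isClosed_biInter fun B hB => (hB.1.1 E P hP).1.1.isClosed
    · exact convex_iInter₂ fun B hB => (hB.1.1 E P hP).1.2.1
  · rintro E F _ _ _ _ _ _ P Q T hP hQ hT _ ⟨z, hz, rfl⟩
    exact mem_injHullB.2 fun B hB hBi hAB =>
      hB.2 E F P Q T hP hQ hT ⟨z, mem_injHullB.1 hz B hB hBi hAB, rfl⟩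
  · intro E _ _ _ P M hP
    apply Set.Subset.antisymm
    · rintro _ ⟨v, hv, rfl⟩
      refine ⟨mem_injHullB.2 fun B hB hBi hAB => ?_, v, rfl⟩
      exact ((hBi E P M hP).subset ⟨v, mem_injHullB.1 hv B hB hBi hAB, rfl⟩).1
    · rintro _ ⟨hz, v, rfl⟩
      refine ⟨v, mem_injHullB.2 fun B hB hBi hAB => ?_, rfl⟩
      obtain ⟨w, hw, hwv⟩ := (hBi E P M hP).superset
        ⟨mem_injHullB.1 hz B hB hBi hAB, v, rfl⟩
      rwa [← map_subtype_injective M hwv]
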